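/- The vector space H, equipped with the shifted concatenation product *, unit the empty word, coproduct Δ(w) = Σ_{I ⊔ J = {1,...,|w|}} pack(w[I]) ⊗ pack(w[J]/w[I]), and counit ε (ε of the empty word is 1, ε(w) = 0 for nonempty packed w), is a Hopf algebra: it is a bialgebra graded by word length with one-dimensional degree-0 component, and therefore admits an antipode. -/

import Mathlib

/-- Words over the alphabet `X = {x_i : i ≥ 0}`, identified with lists of natural numbers. -/
abbrev Word : Type := List ℕ

/-- `IAlph w` is the set of indices of letters occurring in `w`. -/
def IAlph (w : Word) : Finset ℕ := w.toFinset

/-- `wsup w` is the supremum of `IAlph w` (0 for the empty word). -/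
def wsup (w : Word) : ℕ := w.foldr max 0

/-- The substitution `S_φ` replaces each letter `x_i` by `x_{φ i}`. -/
def subst (φ : ℕ → ℕ) (w : Word) : Word := w.map φ

/-- The packing substitution `φ_w`: it sends the `m`-th smallest nonzero letter of `w` to `m`,
and `0` to `0`. -/
def packMap (w : Word) (i : ℕ) : ℕ := (((IAlph w).erase 0).filter (fun j => j ≤ i)).card

/-- `pack w = S_{φ_w} w`. -/
def pack (w : Word) : Word := subst (packMap w) w

/-- A word is packed if `pack w = w`. -/
def IsPacked (w : Word) : Prop := pack w = w

/-- `T_t`: shift every nonzero letter by `t`, fixing `x_0`. -/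
def shiftW (t : ℕ) (w : Word) : Word := subst (fun n => if n = 0 then 0 else n + t) w

/-- Shifted concatenation `u * v = u · T_{sup u}(v)`. -/
def sc (u v : Word) : Word := u ++ shiftW (wsup u) v

/-- `w[I]`: the subword of `w` formed by the letters at the (1-indexed) positions in `I`,
taken in increasing order of position. -/
def subword (w : Word) (I : Finset ℕ) : Word :=
  ((List.range w.length).filter (fun j => decide (j + 1 ∈ I))).map (fun j => w.getD j 0)

/-- Quotient by a set of indices: `w / A = S_{φ_A} w` where `φ_A i = 0` if `i ∈ A`, else `i`. -/
def quotSet (w : Word) (A : Finset ℕ) : Word := subst (fun i => if i ∈ A then 0 else i) w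

/-- Quotient by a word: `w / u = w / IAlph u`. -/
def quotWord (w u : Word) : Word := quotSet w (IAlph u)

/-- The product on the span of words: the bilinear extension of the shifted concatenation. -/
noncomputable def Hmul (k : Type) [Field k] (f g : Word →₀ k) : Word →₀ k :=
  f.sum fun u a => g.sum fun v b => Finsupp.single (sc u v) (a * b)

/-- The coproduct on basis words, with values in `H ⊗ H` identified with the free vector
space on pairs of words:
`Δ(w) = Σ_{I ⊔ J = {1,…,|w|}} pack(w[I]) ⊗ pack(w[J]/w[I])`. -/
noncomputable def coprod (k : Type) [Field k] (w : Word) : (Word × Word) →₀ k :=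
  ∑ I ∈ (Finset.Icc 1 w.length).powerset,
    Finsupp.single
      (pack (subword w I),
        pack (quotWord (subword w (Finset.Icc 1 w.length \ I)) (subword w I)))
      (1 : k)

/-- The product on `H ⊗ H`: componentwise shifted concatenation. -/
noncomputable def HHmul (k : Type) [Field k] (F G : (Word × Word) →₀ k) :
    (Word × Word) →₀ k :=
  F.sum fun p c => G.sum fun q d => Finsupp.single (sc p.1 q.1, sc p.2 q.2) (c * d)

/-! ### Sums over the ways to split a word into two complementary subwords -/

/-- The sum of `f x y` over all ways to split `w` into complementary subwords `x` and `y`. -/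
def splitSum {M : Type*} [AddCommMonoid M] : Word → (Word → Word → M) → M
  | [], f => f [] []
  | a :: w, f => splitSum w (fun x y => f (a :: x) y) + splitSum w (fun x y => f x (a :: y))

section SplitSum

variable {M N : Type*} [AddCommMonoid M] [AddCommMonoid N]

theorem splitSum_append (u v : Word) (f : Word → Word → M) :
    splitSum (u ++ v) f =
      splitSum u fun x y => splitSum v fun x' y' => f (x ++ x') (y ++ y') := by
  induction u generalizing f with
  | nil => rfl
  | cons a u ih => simp [splitSum, ih]

theorem splitSum_map (φ : ℕ → ℕ) (w : Word) (f : Word → Word → M) :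
    splitSum (w.map φ) f = splitSum w fun x y => f (x.map φ) (y.map φ) := by
  induction w generalizing f with
  | nil => rfl
  | cons a w ih => simp [splitSum, ih]

theorem splitSum_congr (w : Word) {f g : Word → Word → M}
    (h : ∀ x y, (x ++ y).Perm w → f x y = g x y) : splitSum w f = splitSum w g := by
  induction w generalizing f g with
  | nil => exact h [] [] (List.Perm.refl _)
  | cons a w ih =>
    simp only [splitSum]
    congr 1
    · exact ih fun x y hp => h _ _ (hp.cons a)
    · exact ih fun x y hp => h _ _ (List.perm_middle.trans (hp.cons a))

theorem splitSum_add (w : Word) (f g : Word → Word → M) :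
    (splitSum w fun x y => f x y + g x y) = splitSum w f + splitSum w g := by
  induction w generalizing f g with
  | nil => rfl
  | cons a w ih => simp only [splitSum, ih]; abel

theorem map_splitSum (φ : M →+ N) (w : Word) (f : Word → Word → M) :
    φ (splitSum w f) = splitSum w fun x y => φ (f x y) := by
  induction w generalizing f with
  | nil => rfl
  | cons a w ih => simp only [splitSum, map_add, ih]

theorem splitSum_zero (w : Word) : (splitSum w fun _ _ => (0 : M)) = 0 := by
  induction w with
  | nil => rfl
  | cons a w ih => simp only [splitSum, ih, add_zero]

theorem splitSum_coassoc (w : Word) (g : Word → Word → Word → M) :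
    (splitSum w fun x y => splitSum x fun a b => g a b y) =
      splitSum w fun x y => splitSum y fun b c => g x b c := by
  induction w generalizing g with
  | nil => rfl
  | cons a w ih => simp only [splitSum, splitSum_add, ih, add_assoc]

theorem splitSum_eq_left_nil (w : Word) (f : Word → Word → M)
    (h : ∀ x y, x ≠ [] → f x y = 0) : splitSum w f = f [] w := by
  induction w generalizing f with
  | nil => rfl
  | cons a w ih =>
    simp only [splitSum]
    rw [ih (fun x y => f x (a :: y)) fun x y hx => h _ _ hx,
      splitSum_congr w (g := fun _ _ => 0) fun x y _ => h _ _ (List.cons_ne_nil _ _),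
      splitSum_zero, zero_add]

theorem splitSum_eq_right_nil (w : Word) (f : Word → Word → M)
    (h : ∀ x y, y ≠ [] → f x y = 0) : splitSum w f = f w [] := by
  induction w generalizing f with
  | nil => rfl
  | cons a w ih =>
    simp only [splitSum]
    rw [ih (fun x y => f (a :: x) y) fun x y hy => h _ _ hy,
      splitSum_congr w (g := fun _ _ => 0) fun x y _ => h _ _ (List.cons_ne_nil _ _),
      splitSum_zero, add_zero]

end SplitSum

theorem subword_append_singleton (w : Word) (a : ℕ) (I : Finset ℕ) :
    subword (w ++ [a]) I = subword w I ++ if w.length + 1 ∈ I then [a] else [] := by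
  unfold subword
  rw [List.length_append, List.length_singleton, List.range_succ, List.filter_append,
    List.map_append]
  congr 1
  · refine List.map_congr_left fun j hj => ?_
    rw [List.mem_filter, List.mem_range] at hj
    exact List.getD_append _ _ _ _ hj.1
  · by_cases h : w.length + 1 ∈ I <;> simp [h]

theorem subword_congr (w : Word) {I J : Finset ℕ}
    (h : ∀ j, j < w.length → (j + 1 ∈ I ↔ j + 1 ∈ J)) : subword w I = subword w J := by
  unfold subword
  congr 1
  refine List.filter_congr fun j hj => ?_
  simp [h j (List.mem_range.1 hj)]

theorem sum_powerset_subword {M : Type*} [AddCommMonoid M] (w : Word) (f : Word → Word → M) :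
    ∑ I ∈ (Finset.Icc 1 w.length).powerset,
      f (subword w I) (subword w (Finset.Icc 1 w.length \ I)) = splitSum w f := by
  induction w using List.reverseRecOn generalizing f with
  | nil => simp [splitSum, subword]
  | append_singleton w a ih =>
    have hI : Finset.Icc 1 (w ++ [a]).length
        = insert (w.length + 1) (Finset.Icc 1 w.length) := by
      ext j; simp; omega
    have hn : w.length + 1 ∉ Finset.Icc 1 w.length := by simp
    rw [hI, Finset.sum_powerset_insert hn, splitSum_append]
    simp only [splitSum, splitSum_add, List.append_nil]
    rw [← ih, ← ih, add_comm]
    congr 1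
    · refine Finset.sum_congr rfl fun I hI => ?_
      rw [subword_append_singleton, subword_append_singleton]
      simp only [Finset.mem_insert_self, Finset.mem_sdiff, not_true_eq_false, and_false,
        if_true, if_false, List.append_nil]
      congr 1
      · congr 1
        exact subword_congr w fun j hj => by simp; omega
      · exact subword_congr w fun j hj => by simp; omega
    · refine Finset.sum_congr rfl fun I hI => ?_
      have hnI : w.length + 1 ∉ I := fun h => hn (Finset.mem_powerset.1 hI h)
      rw [subword_append_singleton, subword_append_singleton]
      simp only [Finset.mem_insert_self, Finset.mem_sdiff, hnI, not_false_eq_true, and_true,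
        if_true, if_false, List.append_nil]
      congr 2
      exact subword_congr w fun j hj => by simp; omega

/-! ### Packing -/

theorem mem_IAlph {w : Word} {i : ℕ} : i ∈ IAlph w ↔ i ∈ w := List.mem_toFinset

theorem packMap_zero (w : Word) : packMap w 0 = 0 := by
  rw [packMap, Finset.card_eq_zero, Finset.filter_eq_empty_iff]
  intro j hj
  have := (Finset.mem_erase.1 hj).1
  omega

theorem packMap_lt {w : Word} {i j : ℕ} (hj : j ∈ w) (hij : i < j) :
    packMap w i < packMap w j := by
  refine Finset.card_lt_card ⟨fun l hl => ?_, fun h => ?_⟩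
  · rw [Finset.mem_filter] at hl ⊢
    exact ⟨hl.1, by omega⟩
  · have := h (Finset.mem_filter.2
      ⟨Finset.mem_erase.2 ⟨by omega, mem_IAlph.2 hj⟩, le_refl j⟩)
    have := (Finset.mem_filter.1 this).2
    omega

/-- `φ` fixes `0` and is strictly increasing on `0` and the letters of `w`. -/
def StrictOn (φ : ℕ → ℕ) (w : Word) : Prop :=
  φ 0 = 0 ∧ ∀ i j, (i = 0 ∨ i ∈ w) → j ∈ w → i < j → φ i < φ j

theorem strictOn_packMap (w : Word) : StrictOn (packMap w) w :=
  ⟨packMap_zero w, fun _ _ _ hj hij => packMap_lt hj hij⟩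

namespace StrictOn

variable {φ : ℕ → ℕ} {w : Word}

theorem mono (h : StrictOn φ w) {x : Word} (hx : ∀ i ∈ x, i = 0 ∨ i ∈ w) : StrictOn φ x := by
  refine ⟨h.1, fun i j hi hj hij => h.2 i j ?_ ?_ hij⟩
  · exact hi.elim Or.inl (hx i)
  · exact (hx j hj).resolve_left (by omega)

theorem lt_iff (h : StrictOn φ w) {i j : ℕ} (hi : i = 0 ∨ i ∈ w) (hj : j = 0 ∨ j ∈ w) :
    φ i < φ j ↔ i < j := by
  have key : ∀ i j, (i = 0 ∨ i ∈ w) → (j = 0 ∨ j ∈ w) → i < j → φ i < φ j :=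
    fun i j hi hj hij => h.2 i j hi (hj.resolve_left (by omega)) hij
  refine ⟨fun hlt => ?_, key i j hi hj⟩
  by_contra hle
  rcases Nat.lt_or_ge j i with hji | hji
  · have := key j i hj hi hji
    omega
  · have : i = j := by omega
    subst this
    omega

theorem eq_iff (h : StrictOn φ w) {i j : ℕ} (hi : i = 0 ∨ i ∈ w) (hj : j = 0 ∨ j ∈ w) :
    φ i = φ j ↔ i = j := by
  have h1 := h.lt_iff hi hj
  have h2 := h.lt_iff hj hi
  omega

theorem packMap_map (h : StrictOn φ w) {i : ℕ} (hi : i ∈ w) :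
    packMap (w.map φ) (φ i) = packMap w i := by
  symm
  refine Finset.card_bij (fun j _ => φ j) ?_ ?_ ?_
  · intro j hj
    simp only [Finset.mem_filter, Finset.mem_erase, mem_IAlph, List.mem_map] at hj ⊢
    have h0 := h.eq_iff (Or.inr hj.1.2) (Or.inl rfl)
    have h1 := h.lt_iff (Or.inr hi) (Or.inr hj.1.2)
    rw [h.1] at h0
    exact ⟨⟨by omega, j, hj.1.2, rfl⟩, by omega⟩
  · intro a ha b hb hab
    simp only [Finset.mem_filter, Finset.mem_erase, mem_IAlph] at ha hb
    exact (h.eq_iff (Or.inr ha.1.2) (Or.inr hb.1.2)).1 hab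
  · intro b hb
    simp only [Finset.mem_filter, Finset.mem_erase, mem_IAlph, List.mem_map] at hb
    obtain ⟨⟨hb0, j, hj, rfl⟩, hle⟩ := hb
    have h1 := h.lt_iff (Or.inr hi) (Or.inr hj)
    refine ⟨j, ?_, rfl⟩
    simp only [Finset.mem_filter, Finset.mem_erase, mem_IAlph]
    refine ⟨⟨?_, hj⟩, by omega⟩
    rintro rfl
    exact hb0 h.1

theorem pack_map (h : StrictOn φ w) : pack (w.map φ) = pack w := by
  simp only [pack, subst, List.map_map]
  exact List.map_congr_left fun i hi => h.packMap_map hi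

theorem quotWord_map (h : StrictOn φ w) {x y : Word} (hx : ∀ i ∈ x, i ∈ w)
    (hy : ∀ i ∈ y, i ∈ w) :
    quotWord (y.map φ) (x.map φ) = (quotWord y x).map φ := by
  simp only [quotWord, quotSet, subst, List.map_map, mem_IAlph]
  refine List.map_congr_left fun i hi => ?_
  have : φ i ∈ x.map φ ↔ i ∈ x := by
    rw [List.mem_map]
    refine ⟨?_, fun hix => ⟨i, hix, rfl⟩⟩
    rintro ⟨j, hj, hji⟩
    rwa [← (h.eq_iff (Or.inr (hx j hj)) (Or.inr (hy i hi))).1 hji]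
  by_cases hix : i ∈ x
  · simp only [Function.comp, if_pos (this.2 hix), if_pos hix, h.1]
  · simp only [Function.comp, if_neg (mt this.1 hix), if_neg hix]

end StrictOn

theorem pack_eq_nil {w : Word} : pack w = [] ↔ w = [] := by simp [pack, subst]

theorem length_pack (w : Word) : (pack w).length = w.length := by simp [pack, subst]

theorem quotWord_eq_nil {w x : Word} : quotWord w x = [] ↔ w = [] := by
  simp [quotWord, quotSet, subst]

theorem length_quotWord (w x : Word) : (quotWord w x).length = w.length := by
  simp [quotWord, quotSet, subst]

theorem quotWord_nil (w : Word) : quotWord w [] = w := by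
  simp [quotWord, quotSet, subst, IAlph]

theorem mem_quotWord {w x : Word} {i : ℕ} (h : i ∈ quotWord w x) : i = 0 ∨ i ∈ w := by
  simp only [quotWord, quotSet, subst, List.mem_map] at h
  obtain ⟨j, hj, rfl⟩ := h
  split_ifs
  · exact Or.inl rfl
  · exact Or.inr hj

theorem quotWord_quotWord (x b c : Word) :
    quotWord (quotWord c x) (quotWord b x) = quotWord c (x ++ b) := by
  simp only [quotWord, quotSet, subst, List.map_map, mem_IAlph]
  refine List.map_congr_left fun i _ => ?_
  by_cases hx : i ∈ x
  · simp [hx]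
  · simp only [Function.comp, hx, if_false, List.mem_append, false_or]
    by_cases h0 : i = 0
    · simp [h0]
    · have : i ∈ b.map (fun i => if i ∈ x then 0 else i) ↔ i ∈ b := by
        rw [List.mem_map]
        constructor
        · rintro ⟨j, hj, hji⟩
          split_ifs at hji with hjx
          · exact absurd hji.symm h0
          · rwa [← hji]
        · exact fun hi => ⟨i, hi, by simp [hx]⟩
      simp [this]

theorem quotWord_congr (w : Word) {x y : Word} (h : x.Perm y) : quotWord w x = quotWord w y := by
  simp only [quotWord, quotSet, subst, mem_IAlph, h.mem_iff]

/-! ### Shifted concatenation -/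

theorem wsup_append (u v : Word) : wsup (u ++ v) = max (wsup u) (wsup v) := by
  induction u with
  | nil => simp [wsup]
  | cons a u ih => simp only [wsup, List.cons_append, List.foldr_cons] at ih ⊢; omega

theorem le_wsup {w : Word} {i : ℕ} (h : i ∈ w) : i ≤ wsup w := by
  induction w with
  | nil => simp at h
  | cons a w ih =>
    simp only [wsup, List.foldr_cons] at ih ⊢
    rcases List.mem_cons.1 h with rfl | h
    · omega
    · have := ih h
      omega

theorem wsup_le {w : Word} {n : ℕ} (h : ∀ i ∈ w, i ≤ n) : wsup w ≤ n := by
  induction w with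
  | nil => exact Nat.zero_le n
  | cons a w ih =>
    simp only [wsup, List.foldr_cons] at ih ⊢
    have := ih fun i hi => h i (List.mem_cons_of_mem _ hi)
    have := h a List.mem_cons_self
    omega

theorem wsup_mem {w : Word} (h : wsup w ≠ 0) : wsup w ∈ w := by
  induction w with
  | nil => exact absurd rfl h
  | cons a w ih =>
    simp only [wsup, List.foldr_cons] at ih h ⊢
    rcases le_total a (w.foldr max 0) with hle | hle
    · rw [max_eq_right hle] at h ⊢
      exact List.mem_cons_of_mem _ (ih h)
    · rw [max_eq_left hle]
      exact List.mem_cons_self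

theorem max_wsup_shiftW (t : ℕ) (v : Word) : max t (wsup (shiftW t v)) = t + wsup v := by
  induction v with
  | nil => simp [wsup, shiftW, subst]
  | cons a v ih =>
    simp only [wsup, shiftW, subst, List.map_cons, List.foldr_cons] at ih ⊢
    split_ifs <;> omega

theorem wsup_sc (u v : Word) : wsup (sc u v) = wsup u + wsup v := by
  rw [sc, wsup_append, max_wsup_shiftW]

theorem shiftW_shiftW (s t : ℕ) (w : Word) : shiftW s (shiftW t w) = shiftW (s + t) w := by
  simp only [shiftW, subst, List.map_map]
  refine List.map_congr_left fun i _ => ?_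
  by_cases h : i = 0
  · simp [h]
  · simp [h]; omega

theorem sc_assoc (u v w : Word) : sc (sc u v) w = sc u (sc v w) := by
  rw [sc, wsup_sc, sc, sc, sc, List.append_assoc, ← shiftW_shiftW]
  simp [shiftW, subst]

theorem sc_nil (u : Word) : sc u [] = u := by simp [sc, shiftW, subst]

theorem nil_sc (u : Word) : sc [] u = u := by
  simp only [sc, shiftW, subst, wsup, List.foldr_nil, List.nil_append]
  conv_rhs => rw [← List.map_id u]
  exact List.map_congr_left fun i _ => by by_cases h : i = 0 <;> simp [h]

theorem length_sc (u v : Word) : (sc u v).length = u.length + v.length := by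
  simp [sc, shiftW, subst]

theorem packMap_of_le {w : Word} {n : ℕ} (h : ∀ i ∈ w, i ≤ n) :
    packMap w n = ((IAlph w).erase 0).card := by
  rw [packMap, Finset.filter_true_of_mem]
  exact fun j hj => h j (mem_IAlph.1 (Finset.mem_of_mem_erase hj))

theorem packMap_le_card (w : Word) (i : ℕ) : packMap w i ≤ ((IAlph w).erase 0).card :=
  Finset.card_filter_le _ _

theorem wsup_pack (w : Word) : wsup (pack w) = ((IAlph w).erase 0).card := by
  apply le_antisymm
  · refine wsup_le fun i hi => ?_
    obtain ⟨j, _, rfl⟩ := List.mem_map.1 hi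
    exact packMap_le_card w j
  · rw [← packMap_of_le (w := w) fun i hi => le_wsup hi]
    by_cases h : wsup w = 0
    · rw [h, packMap_zero]
      exact Nat.zero_le _
    · exact le_wsup (List.mem_map_of_mem (wsup_mem h))

theorem mem_append_shiftW_of_le {x y : Word} {t j : ℕ} (h0 : j ≠ 0) (hj : j ≤ t) :
    j ∈ x ++ shiftW t y ↔ j ∈ x := by
  rw [List.mem_append, or_iff_left_iff_imp]
  intro h
  obtain ⟨i, _, hi⟩ := List.mem_map.1 h
  split_ifs at hi <;> omega

theorem mem_append_shiftW_of_lt {x y : Word} {t j : ℕ} (hx : ∀ i ∈ x, i ≤ t) (hj : t < j) :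
    j ∈ x ++ shiftW t y ↔ j - t ∈ y := by
  rw [List.mem_append, shiftW, subst, List.mem_map]
  constructor
  · rintro (h | ⟨i, hi, h⟩)
    · have := hx j h
      omega
    · split_ifs at h with h0
      · omega
      · have : j - t = i := by omega
        rwa [this]
  · exact fun h => Or.inr ⟨j - t, h, by split_ifs <;> omega⟩

theorem pack_append_shiftW {x y : Word} {t : ℕ} (hx : ∀ i ∈ x, i ≤ t) :
    pack (x ++ shiftW t y) = sc (pack x) (pack y) := by
  have hsmall : ∀ i ≤ t, packMap (x ++ shiftW t y) i = packMap x i := by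
    intro i hi
    unfold packMap
    congr 1
    ext j
    simp only [Finset.mem_filter, Finset.mem_erase, mem_IAlph]
    constructor
    · rintro ⟨⟨h0, hj⟩, hle⟩
      exact ⟨⟨h0, (mem_append_shiftW_of_le h0 (by omega)).1 hj⟩, hle⟩
    · rintro ⟨⟨h0, hj⟩, hle⟩
      exact ⟨⟨h0, (mem_append_shiftW_of_le h0 (by omega)).2 hj⟩, hle⟩
  have hlarge : ∀ i, packMap (x ++ shiftW t y) (i + t)
      = packMap y i + ((IAlph x).erase 0).card := by
    intro i
    have hinj : Set.InjOn (fun j => j + t)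
        ((((IAlph y).erase 0).filter (· ≤ i) : Finset ℕ) : Set ℕ) :=
      fun a _ b _ h => Nat.add_right_cancel h
    have hdisj : Disjoint ((((IAlph y).erase 0).filter (· ≤ i)).image (fun j => j + t))
        ((IAlph x).erase 0) := by
      rw [Finset.disjoint_left]
      intro j hj hjx
      simp only [Finset.mem_image, Finset.mem_filter, Finset.mem_erase, mem_IAlph] at hj hjx
      obtain ⟨l, hl, rfl⟩ := hj
      have := hx _ hjx.2
      omega
    unfold packMap
    rw [← Finset.card_image_of_injOn hinj, ← Finset.card_union_of_disjoint hdisj]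
    congr 1
    ext j
    simp only [Finset.mem_union, Finset.mem_image, Finset.mem_filter, Finset.mem_erase, mem_IAlph]
    rcases Nat.lt_or_ge t j with hj | hj
    · rw [mem_append_shiftW_of_lt hx hj]
      constructor
      · rintro ⟨⟨h0, hm⟩, hle⟩
        exact Or.inl ⟨j - t, ⟨⟨by omega, hm⟩, by omega⟩, by omega⟩
      · rintro (⟨l, ⟨⟨h0, hm⟩, hle⟩, rfl⟩ | ⟨h0, hm⟩)
        · refine ⟨⟨by omega, ?_⟩, by omega⟩
          rwa [Nat.add_sub_cancel]
        · have := hx _ hm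
          omega
    · constructor
      · rintro ⟨⟨h0, hm⟩, hle⟩
        exact Or.inr ⟨h0, (mem_append_shiftW_of_le h0 hj).1 hm⟩
      · rintro (⟨l, ⟨⟨h0, hm⟩, hle⟩, rfl⟩ | ⟨h0, hm⟩)
        · omega
        · exact ⟨⟨h0, (mem_append_shiftW_of_le h0 hj).2 hm⟩, by omega⟩
  rw [sc, wsup_pack]
  simp only [pack]
  generalize hψ : packMap (x ++ shiftW t y) = ψ at hsmall hlarge
  simp only [subst, shiftW, List.map_append, List.map_map]
  congr 1
  · exact List.map_congr_left fun i hi => hsmall i (hx i hi)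
  · refine List.map_congr_left fun i hi => ?_
    by_cases h0 : i = 0
    · simp [h0, packMap_zero, hsmall 0 (Nat.zero_le t)]
    · have hpos : packMap y i ≠ 0 := by
        have := packMap_lt hi (Nat.pos_of_ne_zero h0)
        omega
      simp [h0, hpos, hlarge]

theorem isPacked_sc {u v : Word} (hu : IsPacked u) (hv : IsPacked v) : IsPacked (sc u v) := by
  unfold IsPacked at *
  conv_rhs => rw [← hu, ← hv]
  exact pack_append_shiftW fun i hi => le_wsup hi

theorem quotWord_append_shiftW {x y x' y' : Word} {t : ℕ} (hx : ∀ i ∈ x, i ≤ t)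
    (hy : ∀ i ∈ y, i ≤ t) :
    quotWord (y ++ shiftW t y') (x ++ shiftW t x')
      = quotWord y x ++ shiftW t (quotWord y' x') := by
  simp only [quotWord, quotSet, subst, mem_IAlph, List.map_append]
  congr 1
  · refine List.map_congr_left fun i hi => ?_
    by_cases h0 : i = 0
    · simp [h0]
    · simp only [mem_append_shiftW_of_le h0 (hy i hi)]
  · simp only [shiftW, subst, List.map_map]
    refine List.map_congr_left fun i _ => ?_
    by_cases h0 : i = 0
    · simp [h0]
    · have := mem_append_shiftW_of_lt (y := x') hx (j := i + t) (by omega)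
      rw [Nat.add_sub_cancel] at this
      simp only [shiftW, subst] at this
      simp only [Function.comp, h0, if_false, this]
      by_cases hi : i ∈ x' <;> simp [hi, h0]

/-! ### Sums over the terms of the coproduct -/

/-- The sum of `f p q` over the terms `p ⊗ q` of `Δ(w)`. -/
def coprodSum {M : Type*} [AddCommMonoid M] (w : Word) (f : Word → Word → M) : M :=
  splitSum w fun x y => f (pack x) (pack (quotWord y x))

section CoprodSum

variable {M N : Type*} [AddCommMonoid M] [AddCommMonoid N]

theorem coprodSum_congr (w : Word) {f g : Word → Word → M}
    (h : ∀ p q, p.length + q.length = w.length → f p q = g p q) :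
    coprodSum w f = coprodSum w g :=
  splitSum_congr w fun x y hp => h _ _ (by
    rw [length_pack, length_pack, length_quotWord, ← List.length_append, hp.length_eq])

theorem map_coprodSum (φ : M →+ N) (w : Word) (f : Word → Word → M) :
    φ (coprodSum w f) = coprodSum w fun p q => φ (f p q) :=
  map_splitSum φ w _

theorem coprodSum_pack (w : Word) (f : Word → Word → M) :
    coprodSum (pack w) f = coprodSum w f := by
  have hs := strictOn_packMap w
  unfold coprodSum
  rw [pack, subst, splitSum_map]
  refine splitSum_congr w fun x y hp => ?_
  have hx : ∀ i ∈ x, i ∈ w := fun i hi => hp.mem_iff.1 (List.mem_append_left _ hi)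
  have hy : ∀ i ∈ y, i ∈ w := fun i hi => hp.mem_iff.1 (List.mem_append_right _ hi)
  rw [hs.quotWord_map hx hy, (hs.mono fun i hi => Or.inr (hx i hi)).pack_map,
    (hs.mono fun i hi => (mem_quotWord hi).imp_right (hy i)).pack_map]

theorem coprodSum_quotWord (y x : Word) (f : Word → Word → M) :
    coprodSum (quotWord y x) f =
      splitSum y fun b c => f (pack (quotWord b x)) (pack (quotWord c (x ++ b))) := by
  unfold coprodSum
  rw [quotWord, quotSet, subst, splitSum_map]
  refine splitSum_congr y fun b c _ => ?_
  rw [← quotWord_quotWord]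
  rfl

theorem coprodSum_coassoc (w : Word) (g : Word → Word → Word → M) :
    (coprodSum w fun p q => coprodSum p fun a b => g a b q) =
      coprodSum w fun p q => coprodSum q fun b c => g p b c := by
  have hl : (coprodSum w fun p q => coprodSum p fun a b => g a b q) =
      splitSum w fun x y => splitSum x fun a b =>
        g (pack a) (pack (quotWord b a)) (pack (quotWord y (a ++ b))) := by
    refine splitSum_congr w fun x y _ => ?_
    refine (coprodSum_pack x _).trans ?_
    refine splitSum_congr x fun a b hp => ?_
    rw [quotWord_congr y hp]
  have hr : (coprodSum w fun p q => coprodSum q fun b c => g p b c) =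
      splitSum w fun x y => splitSum y fun b c =>
        g (pack x) (pack (quotWord b x)) (pack (quotWord c (x ++ b))) := by
    refine splitSum_congr w fun x y _ => ?_
    exact (coprodSum_pack _ _).trans (coprodSum_quotWord y x _)
  rw [hl, hr]
  exact splitSum_coassoc w fun a b c =>
    g (pack a) (pack (quotWord b a)) (pack (quotWord c (a ++ b)))

theorem coprodSum_eq_left_nil (w : Word) (f : Word → Word → M)
    (h : ∀ p q, p ≠ [] → f p q = 0) : coprodSum w f = f [] (pack w) := by
  unfold coprodSum
  rw [splitSum_eq_left_nil, quotWord_nil]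
  · rfl
  · exact fun x y hx => h _ _ (mt pack_eq_nil.1 hx)

theorem coprodSum_eq_right_nil (w : Word) (f : Word → Word → M)
    (h : ∀ p q, q ≠ [] → f p q = 0) : coprodSum w f = f (pack w) [] := by
  unfold coprodSum
  rw [splitSum_eq_right_nil]
  · rfl
  · exact fun x y hy => h _ _ (mt (fun e => quotWord_eq_nil.1 (pack_eq_nil.1 e)) hy)

theorem coprodSum_sc (u v : Word) (f : Word → Word → M) :
    coprodSum (sc u v) f =
      coprodSum u fun p q => coprodSum v fun p' q' => f (sc p p') (sc q q') := by
  unfold coprodSum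
  rw [sc, splitSum_append]
  refine splitSum_congr u fun x y hp => ?_
  have hx : ∀ i ∈ x, i ≤ wsup u := fun i hi =>
    le_wsup (hp.mem_iff.1 (List.mem_append_left _ hi))
  have hy : ∀ i ∈ y, i ≤ wsup u := fun i hi =>
    le_wsup (hp.mem_iff.1 (List.mem_append_right _ hi))
  rw [shiftW, subst, splitSum_map]
  refine splitSum_congr v fun x' y' _ => ?_
  have hq : ∀ i ∈ quotWord y x, i ≤ wsup u := fun i hi =>
    (mem_quotWord hi).elim (fun h => h ▸ Nat.zero_le _) (hy i)
  have h1 := pack_append_shiftW (y := x') hx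
  have h2 := pack_append_shiftW (y := quotWord y' x') hq
  rw [← quotWord_append_shiftW hx hy] at h2
  simp only [shiftW, subst] at h1 h2
  rw [h1, h2]

end CoprodSum

section Coprod

variable (k : Type) [Field k]

theorem coprod_eq (w : Word) :
    coprod k w = coprodSum w fun p q => Finsupp.single (p, q) (1 : k) :=
  sum_powerset_subword w fun x y => Finsupp.single (pack x, pack (quotWord y x)) (1 : k)

variable {k}

theorem sum_coprod {M : Type*} [AddCommMonoid M] (w : Word) (h : Word × Word → k → M)
    (h0 : ∀ p, h p 0 = 0) (hadd : ∀ p c d, h p (c + d) = h p c + h p d) :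
    (coprod k w).sum h = coprodSum w fun p q => h (p, q) 1 := by
  let φ : (Word × Word →₀ k) →+ M :=
    Finsupp.liftAddHom fun p => ⟨⟨h p, h0 p⟩, hadd p⟩
  have hφ : ∀ F, φ F = F.sum h := fun F => rfl
  rw [← hφ, coprod_eq, map_coprodSum]
  simp only [hφ, Finsupp.sum_single_index, h0]

theorem coprod_coassoc (w : Word) :
    ((coprod k w).sum fun p c =>
        (coprod k p.1).sum fun q d => Finsupp.single (q.1, q.2, p.2) (c * d)) =
      ((coprod k w).sum fun p c =>
        (coprod k p.2).sum fun q d => Finsupp.single (p.1, q.1, q.2) (c * d)) := by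
  rw [sum_coprod _ _ (by simp) (by simp [add_mul, Finsupp.sum_add]),
    sum_coprod _ _ (by simp) (by simp [add_mul, Finsupp.sum_add])]
  have h1 : ∀ p q : Word,
      ((coprod k p).sum fun r d => Finsupp.single (r.1, r.2, q) ((1 : k) * d)) =
        coprodSum p fun a b => Finsupp.single (a, b, q) 1 := fun p q => by
    rw [sum_coprod _ _ (by simp) (by simp [mul_add])]
    simp only [mul_one]
  have h2 : ∀ p q : Word,
      ((coprod k q).sum fun r d => Finsupp.single (p, r.1, r.2) ((1 : k) * d)) =
        coprodSum q fun b c => Finsupp.single (p, b, c) 1 := fun p q => by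
    rw [sum_coprod _ _ (by simp) (by simp [mul_add])]
    simp only [mul_one]
  simp only [h1, h2]
  exact coprodSum_coassoc w fun a b c => Finsupp.single (a, b, c) 1

theorem coprod_counit_left (w : Word) :
    ((coprod k w).sum fun p c => if p.1 = ([] : Word) then Finsupp.single p.2 c else 0) =
      Finsupp.single (pack w) (1 : k) := by
  rw [sum_coprod _ _ (by simp) (fun p c d => by split_ifs <;> simp),
    coprodSum_eq_left_nil]
  · simp
  · exact fun p q hp => if_neg hp

theorem coprod_counit_right (w : Word) :
    ((coprod k w).sum fun p c => if p.2 = ([] : Word) then Finsupp.single p.1 c else 0) =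
      Finsupp.single (pack w) (1 : k) := by
  rw [sum_coprod _ _ (by simp) (fun p c d => by split_ifs <;> simp),
    coprodSum_eq_right_nil]
  · simp
  · exact fun p q hq => if_neg hq

theorem coprod_sc (u v : Word) :
    coprod k (sc u v) = HHmul k (coprod k u) (coprod k v) := by
  unfold HHmul
  rw [sum_coprod _ _ (by simp) (by simp [add_mul, Finsupp.sum_add]), coprod_eq, coprodSum_sc]
  refine coprodSum_congr u fun p q _ => ?_
  rw [sum_coprod _ _ (by simp) (by simp [mul_add])]
  simp only [mul_one]

theorem coprod_support (w : Word) {p : Word × Word} (hp : p ∈ (coprod k w).support) :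
    p.1.length + p.2.length = w.length := by
  by_contra hne
  refine Finsupp.mem_support_iff.1 hp ?_
  rw [coprod_eq, ← Finsupp.applyAddHom_apply, map_coprodSum]
  refine (coprodSum_congr w (g := fun _ _ => 0) fun q r h => ?_).trans (splitSum_zero w)
  rw [Finsupp.applyAddHom_apply, Finsupp.single_apply, if_neg]
  rintro rfl
  exact hne h

/-! ### The convolution product and the antipode -/

variable (k) in
/-- The product of `H` as a biadditive map. -/
noncomputable def mulHom : (Word →₀ k) →+ (Word →₀ k) →+ (Word →₀ k) :=
  AddMonoidHom.mk' (fun f => AddMonoidHom.mk' (Hmul k f) fun g g' => by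
    simp only [Hmul]
    rw [← Finsupp.sum_add]
    refine Finsupp.sum_congr fun u _ => ?_
    exact Finsupp.sum_add_index' (by simp) (by simp [mul_add])) fun f f' => by
    refine AddMonoidHom.ext fun g => ?_
    change Hmul k (f + f') g = Hmul k f g + Hmul k f' g
    exact Finsupp.sum_add_index' (fun u => by simp) fun u a a' => by
      simp [add_mul, Finsupp.sum_add]

theorem mulHom_apply (f g : Word →₀ k) : mulHom k f g = Hmul k f g := rfl

theorem mulHom_single (u v : Word) (a b : k) :
    mulHom k (Finsupp.single u a) (Finsupp.single v b) = Finsupp.single (sc u v) (a * b) := by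
  simp [mulHom_apply, Hmul]

theorem mulHom_assoc (f g h : Word →₀ k) :
    mulHom k (mulHom k f g) h = mulHom k f (mulHom k g h) := by
  induction f using Finsupp.induction_linear with
  | zero => simp
  | add f f' hf hf' => simp only [map_add, AddMonoidHom.add_apply, hf, hf']
  | single u a =>
    induction g using Finsupp.induction_linear with
    | zero => simp
    | add g g' hg hg' => simp only [map_add, AddMonoidHom.add_apply, hg, hg']
    | single v b =>
      induction h using Finsupp.induction_linear with
      | zero => simp
      | add h h' hh hh' => simp only [map_add, hh, hh']
      | single w c => simp only [mulHom_single, sc_assoc, mul_assoc]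

theorem one_mulHom (f : Word →₀ k) : mulHom k (Finsupp.single [] 1) f = f := by
  induction f using Finsupp.induction_linear with
  | zero => simp
  | add f f' hf hf' => simp only [map_add, hf, hf']
  | single u a => rw [mulHom_single, nil_sc, one_mul]

theorem mulHom_one (f : Word →₀ k) : mulHom k f (Finsupp.single [] 1) = f := by
  induction f using Finsupp.induction_linear with
  | zero => simp
  | add f f' hf hf' => simp only [map_add, AddMonoidHom.add_apply, hf, hf']
  | single u a => rw [mulHom_single, sc_nil, mul_one]

/-- The convolution product of two linear maps given on words. -/
noncomputable def conv (F G : Word → (Word →₀ k)) (w : Word) : Word →₀ k :=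
  coprodSum w fun p q => mulHom k (F p) (G q)

theorem conv_assoc (F G K : Word → (Word →₀ k)) :
    conv (conv F G) K = conv F (conv G K) := by
  funext w
  have hl : ∀ p q, mulHom k (conv F G p) (K q) =
      coprodSum p fun a b => mulHom k (F a) (mulHom k (G b) (K q)) := fun p q => by
    simp only [← mulHom_assoc]
    exact map_coprodSum ((mulHom k).flip (K q)) p _
  have hr : ∀ p q, mulHom k (F p) (conv G K q) =
      coprodSum q fun b c => mulHom k (F p) (mulHom k (G b) (K c)) := fun p q =>
    map_coprodSum (mulHom k (F p)) q _
  rw [conv, conv]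
  simp only [hl, hr]
  exact coprodSum_coassoc w fun a b c => mulHom k (F a) (mulHom k (G b) (K c))

variable (k) in
/-- The unit `η ∘ ε` of the convolution product. -/
noncomputable def convUnit (w : Word) : Word →₀ k :=
  if w = [] then Finsupp.single [] 1 else 0

theorem convUnit_conv (F : Word → (Word →₀ k)) (w : Word) :
    conv (convUnit k) F w = F (pack w) := by
  rw [conv, coprodSum_eq_left_nil]
  · rw [convUnit, if_pos rfl, one_mulHom]
  · intro p q hp
    rw [convUnit, if_neg hp, map_zero, AddMonoidHom.zero_apply]

theorem conv_convUnit (F : Word → (Word →₀ k)) (w : Word) :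
    conv F (convUnit k) w = F (pack w) := by
  rw [conv, coprodSum_eq_right_nil]
  · rw [convUnit, if_pos rfl, mulHom_one]
  · intro p q hq
    rw [convUnit, if_neg hq, map_zero]

variable (k) in
/-- The map `η ∘ ε - Id`, which is locally nilpotent for the convolution product. -/
noncomputable def unitSubId (w : Word) : Word →₀ k :=
  convUnit k w - Finsupp.single w 1

variable (k) in
/-- The convolution powers of `η ∘ ε - Id`. -/
noncomputable def convPow : ℕ → Word → (Word →₀ k)
  | 0 => convUnit k
  | n + 1 => conv (convPow n) (unitSubId k)

theorem convPow_succ' (n : ℕ) : convPow k (n + 1) = conv (unitSubId k) (convPow k n) := by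
  induction n with
  | zero => funext w; simp only [convPow, convUnit_conv, conv_convUnit]
  | succ n ih => exact (congrArg (conv · (unitSubId k)) ih).trans (conv_assoc _ _ _)

theorem convPow_eq_zero {n : ℕ} {w : Word} (h : w.length < n) : convPow k n w = 0 := by
  induction n generalizing w with
  | zero => omega
  | succ n ih =>
    rw [convPow, conv]
    refine (coprodSum_congr w (g := fun _ _ => 0) fun p q hpq => ?_).trans (splitSum_zero w)
    rcases Nat.lt_or_ge p.length n with hp | hp
    · rw [ih hp, map_zero, AddMonoidHom.zero_apply]
    · obtain rfl : q = [] := List.length_eq_zero_iff.1 (by omega)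
      simp [unitSubId, convUnit]

variable (k) in
/-- The antipode, as the geometric series `∑ (η ∘ ε - Id)^n`. -/
noncomputable def antipodeW (w : Word) : Word →₀ k :=
  ∑ n ∈ Finset.range (w.length + 1), convPow k n w

theorem antipodeW_eq {w : Word} {m : ℕ} (h : w.length ≤ m) :
    antipodeW k w = ∑ n ∈ Finset.range (m + 1), convPow k n w := by
  refine Finset.sum_subset (Finset.range_subset_range.2 (by omega)) fun n _ hn => ?_
  rw [Finset.mem_range] at hn
  exact convPow_eq_zero (by omega)

theorem coprodSum_finset_sum {M : Type*} [AddCommMonoid M] (s : Finset ℕ) (w : Word)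
    (f : ℕ → Word → Word → M) :
    (coprodSum w fun p q => ∑ n ∈ s, f n p q) = ∑ n ∈ s, coprodSum w (f n) := by
  induction s using Finset.induction_on with
  | empty => exact splitSum_zero w
  | insert a s ha ih =>
    simp only [Finset.sum_insert ha, ← ih]
    exact splitSum_add w _ _

theorem sum_convPow_succ (w : Word) :
    ∑ n ∈ Finset.range (w.length + 1), convPow k (n + 1) w + convUnit k w = antipodeW k w := by
  rw [antipodeW_eq (Nat.le_succ w.length), Finset.sum_range_succ' _ (w.length + 1)]
  rfl

theorem conv_antipodeW_unitSubId (w : Word) :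
    conv (antipodeW k) (unitSubId k) w + convUnit k w = antipodeW k w := by
  rw [← sum_convPow_succ]
  congr 1
  simp only [convPow, conv]
  rw [← coprodSum_finset_sum]
  refine coprodSum_congr w fun p q hpq => ?_
  rw [antipodeW_eq (m := w.length) (by omega), map_sum, AddMonoidHom.finsetSum_apply]

theorem conv_unitSubId_antipodeW (w : Word) :
    conv (unitSubId k) (antipodeW k) w + convUnit k w = antipodeW k w := by
  rw [← sum_convPow_succ]
  congr 1
  simp only [convPow_succ', conv]
  rw [← coprodSum_finset_sum]
  refine coprodSum_congr w fun p q hpq => ?_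
  rw [antipodeW_eq (m := w.length) (by omega), map_sum]

theorem conv_antipodeW_id {w : Word} (hw : IsPacked w) :
    conv (antipodeW k) (fun q => Finsupp.single q 1) w = convUnit k w := by
  have h : conv (antipodeW k) (fun q => Finsupp.single q 1) w
      + conv (antipodeW k) (unitSubId k) w = antipodeW k w := by
    have h1 := conv_convUnit (antipodeW k) w
    rw [show pack w = w from hw] at h1
    refine Eq.trans ?_ h1
    refine (splitSum_add w _ _).symm.trans (splitSum_congr w fun x y _ => ?_)
    rw [← map_add, unitSubId, add_sub_cancel]
  have h2 := conv_antipodeW_unitSubId (k := k) w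
  rw [← h, add_comm] at h2
  exact (add_right_cancel h2).symm

theorem conv_id_antipodeW {w : Word} (hw : IsPacked w) :
    conv (fun p => Finsupp.single p 1) (antipodeW k) w = convUnit k w := by
  have h : conv (fun p => Finsupp.single p 1) (antipodeW k) w
      + conv (unitSubId k) (antipodeW k) w = antipodeW k w := by
    have h1 := convUnit_conv (antipodeW k) w
    rw [show pack w = w from hw] at h1
    refine Eq.trans ?_ h1
    refine (splitSum_add w _ _).symm.trans (splitSum_congr w fun x y _ => ?_)
    rw [← AddMonoidHom.add_apply, ← map_add, unitSubId, add_sub_cancel]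
  have h2 := conv_unitSubId_antipodeW (k := k) w
  rw [← h, add_comm] at h2
  exact (add_right_cancel h2).symm

end Coprod

/-- `H`, with the shifted concatenation product `*` (unit the empty word),
the coproduct `Δ(w) = Σ_{I ⊔ J = {1,…,|w|}} pack(w[I]) ⊗ pack(w[J]/w[I])` and the counit `ε`,
is a Hopf algebra: the packed words are stable under `*`, which is associative and unital;
`Δ` is coassociative with counit `ε`; `Δ` and `ε` are algebra morphisms (so `H` is a
bialgebra); the bialgebra is graded by word length with one-dimensional degree-0 component;
and there is an antipode `S` satisfying both convolution identities
`m ∘ (S ⊗ Id) ∘ Δ = η ∘ ε = m ∘ (Id ⊗ S) ∘ Δ`. -/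
theorem wmat_is_hopf (k : Type) [Field k] :
    -- associative unital algebra on the span of packed words
    (∀ u v : Word, IsPacked u → IsPacked v → IsPacked (sc u v)) ∧
    (∀ u v w : Word, sc (sc u v) w = sc u (sc v w)) ∧
    (∀ u : Word, sc u [] = u ∧ sc [] u = u) ∧
    -- coassociativity of Δ
    (∀ w : Word, IsPacked w →
      ((coprod k w).sum fun p c =>
          (coprod k p.1).sum fun q d => Finsupp.single (q.1, q.2, p.2) (c * d))
        =
      ((coprod k w).sum fun p c =>
          (coprod k p.2).sum fun q d => Finsupp.single (p.1, q.1, q.2) (c * d))) ∧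
    -- ε is a counit for Δ
    (∀ w : Word, IsPacked w →
      ((coprod k w).sum fun p c => if p.1 = ([] : Word) then Finsupp.single p.2 c else 0)
        = Finsupp.single w (1 : k) ∧
      ((coprod k w).sum fun p c => if p.2 = ([] : Word) then Finsupp.single p.1 c else 0)
        = Finsupp.single w (1 : k)) ∧
    -- Δ is an algebra morphism (bialgebra axiom)
    (∀ u v : Word, IsPacked u → IsPacked v →
      coprod k (sc u v) = HHmul k (coprod k u) (coprod k v)) ∧
    coprod k ([] : Word) = Finsupp.single (([] : Word), ([] : Word)) (1 : k) ∧
    -- the bialgebra is graded by word length, with one-dimensional degree-0 component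
    (∀ u v : Word, (sc u v).length = u.length + v.length) ∧
    (∀ w : Word, ∀ p ∈ (coprod k w).support, p.1.length + p.2.length = w.length) ∧
    (∀ w : Word, IsPacked w → w.length = 0 → w = []) ∧
    -- existence of the antipode
    (∃ S : Word → (Word →₀ k),
      (∀ w : Word, IsPacked w →
        (∑ I ∈ (Finset.Icc 1 w.length).powerset,
            Hmul k (S (pack (subword w I)))
              (Finsupp.single
                (pack (quotWord (subword w (Finset.Icc 1 w.length \ I)) (subword w I)))
                (1 : k)))
          = if w = ([] : Word) then Finsupp.single ([] : Word) (1 : k) else 0) ∧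
      (∀ w : Word, IsPacked w →
        (∑ I ∈ (Finset.Icc 1 w.length).powerset,
            Hmul k (Finsupp.single (pack (subword w I)) (1 : k))
              (S (pack (quotWord (subword w (Finset.Icc 1 w.length \ I)) (subword w I)))))
          = if w = ([] : Word) then Finsupp.single ([] : Word) (1 : k) else 0)) := by
  refine ⟨fun u v => isPacked_sc, sc_assoc, fun u => ⟨sc_nil u, nil_sc u⟩,
    fun w _ => coprod_coassoc w, fun w hw => ?_, fun u v _ _ => coprod_sc u v, ?_, length_sc,
    fun w p hp => coprod_support w hp, fun w _ h => List.length_eq_zero_iff.1 h,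
    antipodeW k, fun w hw => ?_, fun w hw => ?_⟩
  · have h1 := coprod_counit_left (k := k) w
    have h2 := coprod_counit_right (k := k) w
    rw [show pack w = w from hw] at h1 h2
    exact ⟨h1, h2⟩
  · rw [coprod_eq]
    rfl
  · exact (sum_powerset_subword w fun x y => Hmul k (antipodeW k (pack x))
      (Finsupp.single (pack (quotWord y x)) 1)).trans (conv_antipodeW_id hw)
  · exact (sum_powerset_subword w fun x y => Hmul k (Finsupp.single (pack x) 1)
      (antipodeW k (pack (quotWord y x)))).trans (conv_id_antipodeW hw)
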